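/- Norm upper bound for the second-kind operator I + K: for every continuous 2π-periodic function f : ℝ → ℝ, ∫_0^{2π} |f(x) + (Kf)(x)|² dx ≤ (π log 2 − 1)² ∫_0^{2π} |f(x)|² dx. -/

import Mathlib

open Real MeasureTheory Set intervalIntegral

theorem fourierCoeffOn_two_pi (g : ℝ → ℂ) (n : ℤ) :
    fourierCoeffOn two_pi_pos g n =
      (1 / (2 * π) : ℝ) * ∫ x in (0:ℝ)..(2 * π), Complex.exp (-(n * x) * Complex.I) * g x := by
  rw [fourierCoeffOn_eq_integral, sub_zero, Complex.real_smul]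
  congr 1
  refine integral_congr fun x _ => ?_
  simp only [smul_eq_mul]
  rw [fourier_coe_apply]
  congr 2
  have : (π : ℂ) ≠ 0 := by exact_mod_cast pi_ne_zero
  push_cast
  field_simp

theorem Function.Periodic.exists_norm_le_of_continuous {f : ℝ → ℝ} {T : ℝ} (hf : Continuous f)
    (hper : Function.Periodic f T) (hT : T ≠ 0) : ∃ M, ∀ x, ‖f x‖ ≤ M := by
  obtain ⟨M, hM⟩ := (hper.compact_of_continuous hT hf).isBounded.exists_norm_le
  exact ⟨M, fun x => hM _ (mem_range_self x)⟩

/-- A convolution over a period may be computed with the roles of the factors exchanged. -/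
theorem integral_mul_comp_sub_eq {κ f : ℝ → ℝ} {T : ℝ} (hκ : Function.Periodic κ T)
    (hf : Function.Periodic f T) (x : ℝ) :
    ∫ s in (0:ℝ)..T, κ (x - s) * f s = ∫ u in (0:ℝ)..T, κ u * f (x - u) := by
  have h := integral_comp_sub_left (fun u => κ u * f (x - u)) x (a := 0) (b := T)
  simp only [sub_sub_cancel, sub_zero] at h
  rw [h]
  have hp : Function.Periodic (fun u => κ u * f (x - u)) T := fun u => by
    simp only [hκ u, ← sub_sub, hf.sub_eq]
  simpa using hp.intervalIntegral_add_eq (x - T) 0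

theorem continuous_integral_mul_comp_sub {κ f : ℝ → ℝ} {T : ℝ} (hT : T ≠ 0)
    (hκ : IntervalIntegrable κ volume 0 T) (hf : Continuous f) (hper : Function.Periodic f T) :
    Continuous fun x => ∫ u in (0:ℝ)..T, κ u * f (x - u) := by
  obtain ⟨M, hM⟩ := hper.exists_norm_le_of_continuous hf hT
  refine continuous_of_dominated_interval (bound := fun u => ‖κ u‖ * M) (fun x => ?_)
    (fun x => .of_forall fun u _ => ?_) (hκ.norm.mul_const M) (.of_forall fun u _ => by fun_prop)
  · exact hκ.def'.aestronglyMeasurable.mul (by fun_prop)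
  · rw [norm_mul]
    gcongr
    exact hM _

/-- The convolution theorem for Fourier coefficients on `[0, 2π]`. -/
theorem integral_exp_mul_convolution {κ f : ℝ → ℝ} (hκ : IntervalIntegrable κ volume 0 (2 * π))
    (hf : Continuous f) (hper : Function.Periodic f (2 * π)) (n : ℤ) :
    ∫ x in (0:ℝ)..(2 * π), Complex.exp (-(n * x) * Complex.I) *
        ((∫ u in (0:ℝ)..(2 * π), κ u * f (x - u) : ℝ) : ℂ) =
      (∫ u in (0:ℝ)..(2 * π), Complex.exp (-(n * u) * Complex.I) * κ u) *
        ∫ x in (0:ℝ)..(2 * π), Complex.exp (-(n * x) * Complex.I) * f x := by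
  obtain ⟨M, hM⟩ := hper.exists_norm_le_of_continuous hf two_pi_pos.ne'
  have hle := two_pi_pos.le
  have hκ' : IntegrableOn κ (Ioc 0 (2 * π)) :=
    (intervalIntegrable_iff_integrableOn_Ioc_of_le hle).1 hκ
  have hexp : ∀ y : ℝ, ‖Complex.exp (-(n * y) * Complex.I)‖ = 1 := fun y => by
    simpa using Complex.norm_exp_ofReal_mul_I (-(n * y))
  have hintegrable : Integrable (Function.uncurry fun x u : ℝ =>
      (Complex.exp (-(n * x) * Complex.I) * f (x - u)) * (κ u : ℂ))
      ((volume.restrict (Ioc 0 (2 * π))).prod (volume.restrict (Ioc 0 (2 * π)))) := by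
    refine Integrable.bdd_mul (c := M) (Integrable.comp_snd (f := fun u => (κ u : ℂ)) hκ'.ofReal _)
      ?_ (.of_forall ?_)
    · refine Continuous.aestronglyMeasurable ?_
      fun_prop
    · rintro ⟨x, u⟩
      rw [norm_mul, hexp, one_mul, Complex.norm_real]
      exact hM _
  calc
    _ = ∫ x in (0:ℝ)..(2 * π), ∫ u in (0:ℝ)..(2 * π),
          (Complex.exp (-(n * x) * Complex.I) * f (x - u)) * (κ u : ℂ) := by
      refine integral_congr fun x _ => ?_
      rw [← intervalIntegral.integral_ofReal, ← intervalIntegral.integral_const_mul]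
      refine integral_congr fun u _ => ?_
      push_cast
      ring
    _ = ∫ u in (0:ℝ)..(2 * π), ∫ x in (0:ℝ)..(2 * π),
          (Complex.exp (-(n * x) * Complex.I) * f (x - u)) * (κ u : ℂ) := by
      simp only [integral_of_le hle]
      exact integral_integral_swap hintegrable
    _ = ∫ u in (0:ℝ)..(2 * π), Complex.exp (-(n * u) * Complex.I) * κ u *
          ∫ x in (0:ℝ)..(2 * π), Complex.exp (-(n * x) * Complex.I) * f x := by
      refine integral_congr fun u _ => ?_
      have hp : Function.Periodic
          (fun x : ℝ => Complex.exp (-(n * x) * Complex.I) * (f x : ℂ)) (2 * π) := fun x => by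
        simp only [hper x]
        congr 1
        rw [Complex.exp_eq_exp_iff_exists_int]
        exact ⟨-n, by push_cast; ring⟩
      have hshift : ∫ x in (0:ℝ)..(2 * π), Complex.exp (-(n * x) * Complex.I) * f x =
          ∫ x in (0:ℝ)..(2 * π), Complex.exp (-(n * (x - u : ℝ)) * Complex.I) * f (x - u) := by
        rw [integral_comp_sub_right (fun x : ℝ => Complex.exp (-(n * x) * Complex.I) * (f x : ℂ)) u]
        have := hp.intervalIntegral_add_eq 0 (0 - u)
        rwa [zero_add, sub_add_eq_add_sub, zero_add] at this
      rw [hshift, ← intervalIntegral.integral_const_mul]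
      refine integral_congr fun x _ => ?_
      have : Complex.exp (-(n * x) * Complex.I) = Complex.exp (-(n * u) * Complex.I) *
          Complex.exp (-(n * (x - u : ℝ)) * Complex.I) := by
        rw [← Complex.exp_add]
        push_cast
        ring_nf
      simp only [this]
      ring
    _ = _ := intervalIntegral.integral_mul_const _ _

theorem intervalIntegrable_log_abs_sin_half (a b : ℝ) :
    IntervalIntegrable (fun u => log |sin (u / 2)|) volume a b := by
  have h := (intervalIntegrable_log_sin (a := a / 2) (b := b / 2)).comp_mul_left (c := 1 / 2)
  refine IntervalIntegrable.congr (fun u _ => ?_) (by convert h using 1 <;> ring)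
  simp [log_abs, div_eq_inv_mul]

theorem integral_log_abs_sin_half : ∫ u in (0:ℝ)..(2 * π), log |sin (u / 2)| = -(2 * π * log 2) := by
  simp only [log_abs]
  rw [integral_comp_div (fun u => log (sin u)) two_ne_zero]
  simp [integral_log_sin_zero_pi]
  ring

theorem integral_cos_nat_mul {k : ℕ} (hk : k ≠ 0) : ∫ u in (0:ℝ)..(2 * π), cos (k * u) = 0 := by
  rw [integral_comp_mul_left cos (Nat.cast_ne_zero.2 hk), integral_cos, mul_zero, sin_zero,
    sub_zero, show (k : ℝ) * (2 * π) = (2 * k : ℕ) * π by push_cast; ring, sin_nat_mul_pi,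
    smul_zero]

theorem sin_nat_mul_eq_sin_half_mul_sum (n : ℕ) (u : ℝ) :
    sin (n * u) = sin (u / 2) * ∑ j ∈ Finset.range n, 2 * cos ((j + 1 / 2) * u) := by
  induction n with
  | zero => simp
  | succ n ih =>
    rw [Finset.sum_range_succ, mul_add, ← ih]
    have h1 : ((n + 1 : ℕ) : ℝ) * u = (n + 1 / 2) * u + u / 2 := by push_cast; ring
    have h2 : (n : ℝ) * u = (n + 1 / 2) * u - u / 2 := by ring
    rw [h1, h2, sin_add, sin_sub]
    ring

theorem integral_cos_half_mul_sum_nonneg (n : ℕ) :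
    0 ≤ ∫ u in (0:ℝ)..(2 * π),
      cos (u / 2) * ∑ j ∈ Finset.range n, 2 * cos ((j + 1 / 2) * u) := by
  simp only [Finset.mul_sum]
  rw [intervalIntegral.integral_finsetSum fun j _ => Continuous.intervalIntegrable (by fun_prop) _ _]
  refine Finset.sum_nonneg fun j _ => ?_
  have h : ∀ u : ℝ, cos (u / 2) * (2 * cos ((j + 1 / 2) * u)) =
      cos ((j + 1 : ℕ) * u) + cos (j * u) := fun u => by
    have h1 : ((j + 1 : ℕ) : ℝ) * u = (j + 1 / 2) * u + u / 2 := by push_cast; ring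
    have h2 : (j : ℝ) * u = (j + 1 / 2) * u - u / 2 := by ring
    rw [h1, h2, cos_add, cos_sub]
    ring
  simp only [h]
  rw [intervalIntegral.integral_add (Continuous.intervalIntegrable (by fun_prop) _ _)
    (Continuous.intervalIntegrable (by fun_prop) _ _), integral_cos_nat_mul j.succ_ne_zero, zero_add]
  rcases eq_or_ne j 0 with rfl | hj
  · simp [pi_pos.le]
  · exact (integral_cos_nat_mul hj).ge

theorem integral_log_abs_sin_half_mul_cos_nonpos {n : ℕ} (hn : n ≠ 0) :
    ∫ u in (0:ℝ)..(2 * π), log |sin (u / 2)| * cos (n * u) ≤ 0 := by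
  have hn' : (n : ℝ) ≠ 0 := Nat.cast_ne_zero.2 hn
  set P : ℝ → ℝ := fun u => ∑ j ∈ Finset.range n, 2 * cos ((j + 1 / 2) * u) with hP
  have hPc : Continuous P := by fun_prop
  have hintegrable : IntervalIntegrable (fun u => log |sin (u / 2)| * cos (n * u)) volume 0 (2 * π) :=
    (intervalIntegrable_log_abs_sin_half _ _).mul_continuousOn (by fun_prop)
  have hintCot : IntervalIntegrable (fun u => cos (u / 2) * P u / (2 * n)) volume 0 (2 * π) :=
    Continuous.intervalIntegrable (by fun_prop) _ _
  have key : ∫ u in (0:ℝ)..(2 * π), (log |sin (u / 2)| * cos (n * u) +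
      cos (u / 2) * P u / (2 * n)) = 0 := by
    have hc : Continuous fun u => sin (u / 2) * log (sin (u / 2)) * P u / n :=
    ((continuous_mul_log.comp (by fun_prop : Continuous fun u : ℝ => sin (u / 2))).mul
        hPc).div_const _
    rw [integral_eq_sub_of_hasDerivAt_of_le two_pi_pos.le hc.continuousOn ?_ (hintegrable.add hintCot)]
    · simp
    · rintro u ⟨h0, h1⟩
      have hs : sin (u / 2) ≠ 0 := (sin_pos_of_pos_of_lt_pi (by linarith) (by linarith)).ne'
      have hfun : (fun u => sin (u / 2) * log (sin (u / 2)) * P u / n) =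
          fun u => log (sin (u / 2)) * sin (n * u) / n := by
        ext v
        rw [sin_nat_mul_eq_sin_half_mul_sum]
        ring
      rw [hfun]
      have hd1 : HasDerivAt (fun u : ℝ => sin (u / 2)) (cos (u / 2) * (1 / 2)) u :=
        ((hasDerivAt_id u).div_const 2).sin
      have hd2 : HasDerivAt (fun u : ℝ => sin (n * u)) (cos (n * u) * (n * 1)) u :=
        ((hasDerivAt_id u).const_mul (n : ℝ)).sin
      refine (((hd1.log hs).mul hd2).div_const (n : ℝ)).congr_deriv ?_
      rw [sin_nat_mul_eq_sin_half_mul_sum, log_abs]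
      simp only [hP]
      field_simp
      ring
  rw [intervalIntegral.integral_add hintegrable hintCot, intervalIntegral.integral_div] at key
  have := div_nonneg (integral_cos_half_mul_sum_nonneg n) (by positivity : (0:ℝ) ≤ 2 * n)
  linarith

theorem neg_le_integral_log_abs_sin_half_mul_cos (n : ℤ) :
    -(2 * π * log 2) ≤ ∫ u in (0:ℝ)..(2 * π), log |sin (u / 2)| * cos (n * u) := by
  rw [← integral_log_abs_sin_half]
  refine intervalIntegral.integral_mono_on two_pi_pos.le (intervalIntegrable_log_abs_sin_half _ _)
    ((intervalIntegrable_log_abs_sin_half _ _).mul_continuousOn (by fun_prop)) fun u _ => ?_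
  have : log |sin (u / 2)| ≤ 0 := log_nonpos (abs_nonneg _) (abs_sin_le_one _)
  nlinarith [cos_le_one (n * u)]

theorem integral_log_abs_sin_half_mul_cos_int_nonpos (n : ℤ) :
    ∫ u in (0:ℝ)..(2 * π), log |sin (u / 2)| * cos (n * u) ≤ 0 := by
  rcases eq_or_ne n 0 with rfl | hn
  · simp only [Int.cast_zero, zero_mul, cos_zero, mul_one, integral_log_abs_sin_half]
    have := log_pos one_lt_two
    have := pi_pos
    simp only [Left.neg_nonpos_iff]
    positivity
  · have h : ∀ u : ℝ, cos (n * u) = cos (n.natAbs * u) := fun u => by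
      rw [← cos_abs, ← cos_abs (n.natAbs * u), abs_mul, abs_mul, Nat.abs_cast, Nat.cast_natAbs,
        Int.cast_abs]
    simp only [h]
    exact integral_log_abs_sin_half_mul_cos_nonpos (Int.natAbs_ne_zero.2 hn)

theorem integral_log_abs_sin_half_mul_sin (n : ℤ) :
    ∫ u in (0:ℝ)..(2 * π), log |sin (u / 2)| * sin (n * u) = 0 := by
  have h := integral_comp_sub_left (fun u => log |sin (u / 2)| * sin (n * u)) (2 * π)
    (a := 0) (b := 2 * π)
  have h2 : ∀ u : ℝ, log |sin ((2 * π - u) / 2)| * sin (n * (2 * π - u)) =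
      -(log |sin (u / 2)| * sin (n * u)) := fun u => by
    rw [sub_div, mul_div_cancel_left₀ _ two_ne_zero, sin_pi_sub, mul_sub, sin_int_mul_two_pi_sub]
    ring
  simp only [h2, sub_self, sub_zero, intervalIntegral.integral_neg] at h
  linarith

theorem integral_exp_mul_log_abs_sin_half (n : ℤ) :
    ∫ u in (0:ℝ)..(2 * π), Complex.exp (-(n * u) * Complex.I) *
        ((1 / 2 * log |sin (u / 2)| : ℝ) : ℂ) =
      ((1 / 2 * ∫ u in (0:ℝ)..(2 * π), log |sin (u / 2)| * cos (n * u) : ℝ) : ℂ) := by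
  have hL := intervalIntegrable_log_abs_sin_half 0 (2 * π)
  have hintegrable : ∀ {g : ℝ → ℝ}, Continuous g →
      IntervalIntegrable (fun u => ((log |sin (u / 2)| * g u : ℝ) : ℂ)) volume 0 (2 * π) :=
    fun hg => have h := hL.mul_continuousOn hg.continuousOn; ⟨h.1.ofReal, h.2.ofReal⟩
  have h : ∀ u : ℝ, Complex.exp (-(n * u) * Complex.I) * ((1 / 2 * log |sin (u / 2)| : ℝ) : ℂ) =
      1 / 2 * ((log |sin (u / 2)| * cos (n * u) : ℝ) : ℂ) -
        Complex.I / 2 * ((log |sin (u / 2)| * sin (n * u) : ℝ) : ℂ) := fun u => by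
    rw [Complex.exp_mul_I, Complex.cos_neg, Complex.sin_neg]
    push_cast
    ring
  simp only [h]
  rw [intervalIntegral.integral_sub, intervalIntegral.integral_const_mul,
    intervalIntegral.integral_const_mul, intervalIntegral.integral_ofReal,
    intervalIntegral.integral_ofReal, integral_log_abs_sin_half_mul_sin]
  · simp
  · exact (hintegrable (by fun_prop)).const_mul _
  · exact (hintegrable (by fun_prop)).const_mul _

/-- An operator acting on Fourier coefficients by a bounded multiplier is bounded in `L²`. -/
theorem integral_sq_le_of_fourierCoeffOn_norm_le {a b C : ℝ} (hab : a < b) {f g : ℝ → ℝ}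
    (hf : Continuous f) (hg : Continuous g)
    (h : ∀ n, ‖fourierCoeffOn hab (fun x => (g x : ℂ)) n‖ ≤
      C * ‖fourierCoeffOn hab (fun x => (f x : ℂ)) n‖) :
    ∫ x in a..b, |g x| ^ 2 ≤ C ^ 2 * ∫ x in a..b, |f x| ^ 2 := by
  have hL2 : ∀ {φ : ℝ → ℝ}, Continuous φ →
      MemLp (fun x => (φ x : ℂ)) 2 (volume.restrict (Ioc a b)) := fun {φ} hφ => by
    have hφ' : Continuous fun x => (φ x : ℂ) := Complex.continuous_ofReal.comp hφ
    obtain ⟨M, hM⟩ := (isCompact_Icc (a := a) (b := b)).exists_bound_of_continuousOn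
      hφ'.continuousOn
    exact .of_bound hφ'.aestronglyMeasurable M
      (ae_restrict_of_forall_mem measurableSet_Ioc fun x hx => hM x (Ioc_subset_Icc_self hx))
  have hsf := hasSum_sq_fourierCoeffOn hab (hL2 hf)
  have hsg := hasSum_sq_fourierCoeffOn hab (hL2 hg)
  have hle := hasSum_le (fun n => ?_) hsg (hsf.mul_left (C ^ 2))
  · simp only [Complex.norm_real, norm_eq_abs, smul_eq_mul] at hle
    rw [mul_left_comm] at hle
    exact le_of_mul_le_mul_left hle (inv_pos.2 (sub_pos.2 hab))
  · rw [← mul_pow]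
    exact pow_le_pow_left₀ (norm_nonneg _) (h n) 2

theorem second_kind_operator_norm_upper_bound
    (f : ℝ → ℝ) (hf : Continuous f) (hper : Function.Periodic f (2 * Real.pi)) :
    (∫ x in (0:ℝ)..(2 * Real.pi),
        |f x + ∫ s in (0:ℝ)..(2 * Real.pi),
            (1 / 2 : ℝ) * Real.log |Real.sin ((x - s) / 2)| * f s| ^ 2)
      ≤ (Real.pi * Real.log 2 - 1) ^ 2 * ∫ x in (0:ℝ)..(2 * Real.pi), |f x| ^ 2 := by
  have hlog : 2 ≤ π * log 2 := by nlinarith [pi_gt_three, log_two_gt_d9]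
  have hκ : IntervalIntegrable (fun u => 1 / 2 * log |sin (u / 2)|) volume 0 (2 * π) :=
    (intervalIntegrable_log_abs_sin_half _ _).const_mul _
  have hκper : Function.Periodic (fun u => 1 / 2 * log |sin (u / 2)|) (2 * π) := fun u => by
    simp only [add_div, mul_div_cancel_left₀ π two_ne_zero, sin_add_pi, abs_neg]
  have hconv := integral_mul_comp_sub_eq hκper hper
  have hcont := continuous_integral_mul_comp_sub two_pi_pos.ne' hκ hf hper
  simp only [hconv]
  refine integral_sq_le_of_fourierCoeffOn_norm_le two_pi_pos hf (hf.add hcont)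
    fun n => ?_
  have hcoeff : fourierCoeffOn two_pi_pos (fun x => ((f x +
      ∫ u in (0:ℝ)..(2 * π), 1 / 2 * log |sin (u / 2)| * f (x - u) : ℝ) : ℂ)) n =
      ((1 + 1 / 2 * ∫ u in (0:ℝ)..(2 * π), log |sin (u / 2)| * cos (n * u) : ℝ) : ℂ) *
        fourierCoeffOn two_pi_pos (fun x => (f x : ℂ)) n := by
    simp only [fourierCoeffOn_two_pi, Complex.ofReal_add, mul_add]
    rw [intervalIntegral.integral_add, integral_exp_mul_convolution hκ hf hper,
      integral_exp_mul_log_abs_sin_half]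
    · push_cast
      ring
    · exact Continuous.intervalIntegrable (by fun_prop) _ _
    · exact Continuous.intervalIntegrable
        (.mul (by fun_prop) (Complex.continuous_ofReal.comp hcont)) _ _
  rw [hcoeff, norm_mul, Complex.norm_real, norm_eq_abs]
  refine mul_le_mul_of_nonneg_right (abs_le.2 ⟨?_, ?_⟩) (norm_nonneg _)
  · linarith [neg_le_integral_log_abs_sin_half_mul_cos n]
  · linarith [integral_log_abs_sin_half_mul_cos_int_nonpos n]
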